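/- Let S̃ := {Z ∈ M : z₁₂ = 0} ∪ ⋃_{n≥1} S_n. Then S̃ is a closed subset of M, and its complement M ∖ S̃ is a nonempty open subset of M. In particular, the set ⋃_{n≥1} S_n of normalized Riemann matrices (parametrizing the projective algebraic 2-tori) is not dense in M. -/

import Mathlib

/-- The moduli space `M` of 2×2 complex matrices `Z` with `det (Im Z) > 0`. -/
def Mset : Set (Matrix (Fin 2) (Fin 2) ℂ) :=
  {Z | 0 < (Matrix.of fun i j => (Z i j).im).det}

/-- `S_n ⊆ M` (as a subset of the subspace `M`): `z₂₁ = n z₁₂`. -/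
def Sn (n : ℕ) : Set ↥Mset :=
  {Z | (Z : Matrix (Fin 2) (Fin 2) ℂ) 1 0 = (n : ℂ) * (Z : Matrix (Fin 2) (Fin 2) ℂ) 0 1}

/-- `S₀ ⊆ M`: the locus `z₁₂ = 0`. -/
def S0 : Set ↥Mset :=
  {Z | (Z : Matrix (Fin 2) (Fin 2) ℂ) 0 1 = 0}

theorem isClosed_image_natCast_complex (s : Set ℕ) :
    IsClosed ((fun n : ℕ => (n : ℂ)) '' s) := by
  have h := (Complex.isometry_ofReal.isClosedEmbedding.comp Nat.isClosedEmbedding_coe_real).isClosedMap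
    s (isClosed_discrete s)
  simpa [Function.comp_def] using h

theorem compl_S0_union_Sn :
    (S0 ∪ ⋃ n : ℕ, ⋃ _ : 1 ≤ n, Sn n)ᶜ =
      {Z : ↥Mset | Z.1 0 1 ≠ 0} ∩
        (fun Z : ↥Mset => Z.1 1 0 / Z.1 0 1) ⁻¹' ((fun n : ℕ => (n : ℂ)) '' Set.Ici 1)ᶜ := by
  ext Z
  by_cases hZ : Z.1 0 1 = 0
  · simp [S0, hZ]
  · simp [S0, Sn, eq_div_iff hZ, eq_comm]

theorem isOpen_compl_S0_union_Sn : IsOpen (S0 ∪ ⋃ n : ℕ, ⋃ _ : 1 ≤ n, Sn n)ᶜ := by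
  have entry : ∀ i j : Fin 2, Continuous fun Z : ↥Mset => Z.1 i j := fun i j =>
    continuous_subtype_val.matrix_elem i j
  rw [compl_S0_union_Sn]
  exact ((entry 1 0).continuousOn.div (entry 0 1).continuousOn fun _ h => h).isOpen_inter_preimage
    (isOpen_ne_fun (entry 0 1) continuous_const) (isClosed_image_natCast_complex _).isOpen_compl

theorem nonempty_compl_S0_union_Sn :
    ((S0 ∪ ⋃ n : ℕ, ⋃ _ : 1 ≤ n, Sn n)ᶜ).Nonempty := by
  refine ⟨⟨!![Complex.I, 1; -1, Complex.I], by simp [Mset, Matrix.det_fin_two]⟩, ?_⟩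
  simp only [S0, Sn, Set.mem_compl_iff, Set.mem_union, Set.mem_iUnion, Set.mem_ofPred_eq]
  rintro (h | ⟨n, -, h⟩)
  · simp at h
  · have h_re := congrArg Complex.re h
    simp at h_re
    have hn : (0 : ℝ) ≤ n := n.cast_nonneg
    linarith

/-- `S̃ = S₀ ∪ ⋃_{n≥1} S_n` is closed in `M`, its complement is a nonempty open
subset of `M`; in particular the set `⋃_{n≥1} S_n` of normalized Riemann matrices
(parametrizing the projective algebraic 2-tori) is not dense in `M`. -/
theorem riemann_matrices_not_dense :
    IsClosed (S0 ∪ ⋃ n : ℕ, ⋃ _ : 1 ≤ n, Sn n) ∧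
    IsOpen (S0 ∪ ⋃ n : ℕ, ⋃ _ : 1 ≤ n, Sn n)ᶜ ∧
    ((S0 ∪ ⋃ n : ℕ, ⋃ _ : 1 ≤ n, Sn n)ᶜ).Nonempty ∧
    ¬ Dense (⋃ n : ℕ, ⋃ _ : 1 ≤ n, Sn n) := by
  have h_open := isOpen_compl_S0_union_Sn
  have h_closed := isOpen_compl_iff.mp h_open
  refine ⟨h_closed, h_open, nonempty_compl_S0_union_Sn, fun h_dense => ?_⟩
  obtain ⟨Z, hZ⟩ := nonempty_compl_S0_union_Sn
  exact hZ (h_closed.closure_subset_iff.mpr Set.subset_union_right (h_dense Z))
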